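/- Let N be a natural number, λ : ℝ with λ ≠ (N² − 1)/2, and v : Fin N → ℝ nonzero with J_N.mulVec v = λ • v. Set u := (Ψ_N * Λ_N).mulVec v. Then the vectors w₊ := v + u and w₋ := v − u are both nonzero, (Ψ_N * Λ_N).mulVec w₊ = w₊, and (Ψ_N * Λ_N).mulVec w₋ = −w₋; i.e. w₊ and w₋ are eigenvectors of the binomial transform Ψ_N Λ_N with eigenvalues +1 and −1 respectively. -/

import Mathlib

open Matrix

/-- The `N × N` symmetric Pascal matrix, `(T_N)_{jk} = C(j+k, j)`. -/
noncomputable def pascalT (N : ℕ) : Matrix (Fin N) (Fin N) ℝ :=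
  fun j k => (Nat.choose (j.1 + k.1) j.1 : ℝ)

/-- The `N × N` lower-triangular Pascal matrix, `(Ψ_N)_{jk} = C(j, k)`. -/
noncomputable def psiMat (N : ℕ) : Matrix (Fin N) (Fin N) ℝ :=
  fun j k => (Nat.choose j.1 k.1 : ℝ)

/-- The `N × N` diagonal sign matrix `Λ_N = diag(1, -1, 1, …)`. -/
noncomputable def lamMat (N : ℕ) : Matrix (Fin N) (Fin N) ℝ :=
  Matrix.diagonal fun j => (-1 : ℝ) ^ j.1

/-- The `N × N` symmetric tridiagonal (Jacobi) matrix `J_N` with diagonal entries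
`(J_N)_{jj} = -N²·j + 2j³ + 3j² + 2j` and off-diagonal entries
`(J_N)_{j,j+1} = (J_N)_{j+1,j} = (j+1)·(N² - (j+1)²)`. -/
noncomputable def jacobiJ (N : ℕ) : Matrix (Fin N) (Fin N) ℝ :=
  fun j k =>
    if j.1 = k.1 then
      -((N : ℝ) ^ 2) * (j.1 : ℝ) + 2 * (j.1 : ℝ) ^ 3 + 3 * (j.1 : ℝ) ^ 2 + 2 * (j.1 : ℝ)
    else if j.1 + 1 = k.1 then (k.1 : ℝ) * ((N : ℝ) ^ 2 - (k.1 : ℝ) ^ 2)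
    else if k.1 + 1 = j.1 then (j.1 : ℝ) * ((N : ℝ) ^ 2 - (j.1 : ℝ) ^ 2)
    else 0

open Finset in
theorem sum_neg_one_pow_mul_choose_mul_choose (j k M : ℕ) (hj : j < M) :
    ∑ l ∈ range M, (j.choose l : ℝ) * (-1) ^ l * (l.choose k : ℝ)
      = if j = k then (-1) ^ j else 0 := by
  have h := fwdDiff_iter_choose_zero k j
  rw [fwdDiff_iter_eq_sum_shift] at h
  have h' : ∑ l ∈ range (j + 1), (-1 : ℝ) ^ (j - l) * (j.choose l : ℝ) * (l.choose k : ℝ)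
      = if j = k then 1 else 0 := by
    have := congrArg (Int.cast : ℤ → ℝ) h
    simpa using this
  have h'' : ∑ l ∈ range (j + 1), (j.choose l : ℝ) * (-1) ^ l * (l.choose k : ℝ)
      = (-1) ^ j * if j = k then 1 else 0 := by
    rw [← h', mul_sum]
    refine sum_congr rfl fun l hl => ?_
    have hl : l ≤ j := Nat.lt_succ_iff.mp (mem_range.mp hl)
    have hs : (-1 : ℝ) ^ l = (-1) ^ j * (-1) ^ (j - l) := by
      obtain ⟨d, rfl⟩ := Nat.exists_eq_add_of_le hl
      rw [Nat.add_sub_cancel_left, pow_add, mul_assoc, ← mul_pow]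
      simp
    rw [hs]
    ring
  rw [← sum_subset (range_mono (Nat.succ_le_of_lt hj)), h'']
  · simp
  · intro l _ hl
    have : j < l := by simpa using hl
    simp [Nat.choose_eq_zero_of_lt this]

theorem psiMat_mul_lamMat_apply (N : ℕ) (j k : Fin N) :
    (psiMat N * lamMat N) j k = (j.1.choose k.1 : ℝ) * (-1) ^ k.1 := by
  simp [psiMat, lamMat, Matrix.mul_diagonal]

theorem psiMat_mul_lamMat_mul_self (N : ℕ) :
    (psiMat N * lamMat N) * (psiMat N * lamMat N) = 1 := by
  ext j k
  simp only [Matrix.mul_apply (M := psiMat N * lamMat N), psiMat_mul_lamMat_apply,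
    ← mul_assoc, ← Finset.sum_mul]
  rw [Fin.sum_univ_eq_sum_range (fun l => (j.1.choose l : ℝ) * (-1) ^ l * (l.choose k.1 : ℝ)) N,
    sum_neg_one_pow_mul_choose_mul_choose _ _ _ j.2]
  by_cases h : j = k
  · subst h
    simp [← mul_pow]
  · simp [h, Fin.val_inj]

theorem jacobiJ_transpose (N : ℕ) : (jacobiJ N)ᵀ = jacobiJ N := by
  ext j k
  simp only [Matrix.transpose_apply, jacobiJ]
  grind

/-- The action of `jacobiJ N` on the restriction of `f : ℕ → ℝ`; no boundary terms appear since
the off-diagonal entries vanish at `0` and at `N`. -/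
theorem sum_jacobiJ_mul (N : ℕ) (j : Fin N) (f : ℕ → ℝ) :
    ∑ l : Fin N, jacobiJ N j l * f l =
      (-((N : ℝ) ^ 2) * (j.1 : ℝ) + 2 * (j.1 : ℝ) ^ 3 + 3 * (j.1 : ℝ) ^ 2 + 2 * (j.1 : ℝ)) * f j
      + ((j.1 : ℝ) + 1) * ((N : ℝ) ^ 2 - ((j.1 : ℝ) + 1) ^ 2) * f (j + 1)
      + (j.1 : ℝ) * ((N : ℝ) ^ 2 - (j.1 : ℝ) ^ 2) * f (j - 1) := by
  obtain ⟨j, hj⟩ := j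
  have hsplit : ∀ l : ℕ,
      (if j = l then
          -((N : ℝ) ^ 2) * (j : ℝ) + 2 * (j : ℝ) ^ 3 + 3 * (j : ℝ) ^ 2 + 2 * (j : ℝ)
        else if j + 1 = l then (l : ℝ) * ((N : ℝ) ^ 2 - (l : ℝ) ^ 2)
        else if l + 1 = j then (j : ℝ) * ((N : ℝ) ^ 2 - (j : ℝ) ^ 2)
        else 0) * f l =
      (if j = l then
        (-((N : ℝ) ^ 2) * (j : ℝ) + 2 * (j : ℝ) ^ 3 + 3 * (j : ℝ) ^ 2 + 2 * (j : ℝ)) * f j else 0)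
      + (if j + 1 = l then ((j : ℝ) + 1) * ((N : ℝ) ^ 2 - ((j : ℝ) + 1) ^ 2) * f (j + 1) else 0)
      + (if j - 1 = l then (j : ℝ) * ((N : ℝ) ^ 2 - (j : ℝ) ^ 2) * f (j - 1) else 0) := by
    intro l
    rcases Nat.eq_zero_or_pos j with rfl | hpos
    · by_cases h1 : 0 = l
      · subst h1; simp
      · by_cases h2 : 0 + 1 = l
        · subst h2; simp
        · simp [h1, h2]
    · by_cases h1 : j = l
      · subst h1
        simp [show j - 1 ≠ j by omega]
      · by_cases h2 : j + 1 = l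
        · subst h2
          simp [show j - 1 ≠ j + 1 by omega]
        · by_cases h3 : l + 1 = j
          · subst h3
            simp [show l + 1 + 1 ≠ l by omega]
          · simp [h1, h2, h3, show j - 1 ≠ l by omega]
  simp only [jacobiJ]
  rw [Fin.sum_univ_eq_sum_range (fun l => (if j = l then
          -((N : ℝ) ^ 2) * (j : ℝ) + 2 * (j : ℝ) ^ 3 + 3 * (j : ℝ) ^ 2 + 2 * (j : ℝ)
        else if j + 1 = l then (l : ℝ) * ((N : ℝ) ^ 2 - (l : ℝ) ^ 2)
        else if l + 1 = j then (j : ℝ) * ((N : ℝ) ^ 2 - (j : ℝ) ^ 2)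
        else 0) * f l) N]
  simp only [hsplit, Finset.sum_add_distrib, Finset.sum_ite_eq, Finset.mem_range]
  rw [if_pos hj, if_pos (show j - 1 < N by omega)]
  split_ifs with h
  · rfl
  · have : (N : ℝ) = j + 1 := by exact_mod_cast (show N = j + 1 by omega)
    simp [this]

theorem jacobiJ_mul_add_mul_jacobiJ (N : ℕ) :
    jacobiJ N * (psiMat N * lamMat N) + (psiMat N * lamMat N) * jacobiJ N
      = ((N : ℝ) ^ 2 - 1) • (psiMat N * lamMat N) := by
  ext j k
  have hJ : ∀ l, jacobiJ N l k = jacobiJ N k l := fun l =>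
    congrFun (congrFun (jacobiJ_transpose N) k) l
  rw [Matrix.add_apply, Matrix.mul_apply, Matrix.mul_apply, Matrix.smul_apply]
  simp only [psiMat_mul_lamMat_apply, hJ, smul_eq_mul]
  simp only [mul_comm _ (jacobiJ N k _)]
  rw [sum_jacobiJ_mul N j (fun l => (l.choose k.1 : ℝ) * (-1) ^ k.1),
    sum_jacobiJ_mul N k (fun l => (j.1.choose l : ℝ) * (-1) ^ l)]
  obtain ⟨j, hj⟩ := j
  obtain ⟨k, hk⟩ := k
  simp only
  have hup : ((k : ℝ) + 1) * (j.choose (k + 1) : ℝ) = ((j : ℝ) - k) * (j.choose k : ℝ) := by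
    have := Nat.add_one_mul_choose_eq j k
    have h2 : (j.choose k : ℝ) * (j + 1) = (j.choose k + j.choose (k + 1)) * (k + 1) := by
      rw [Nat.choose_succ_succ] at this
      have := congrArg (Nat.cast : ℕ → ℝ) this
      push_cast at this
      linarith
    linarith
  have hdown : (j : ℝ) * ((j - 1).choose k : ℝ) = ((j : ℝ) - k) * (j.choose k : ℝ) := by
    rcases j with _ | j
    · rcases k with _ | k <;> simp
    · have := Nat.choose_mul_succ_eq j k
      rcases le_or_gt k (j + 1) with hkj | hkj
      · have := congrArg (Nat.cast : ℕ → ℝ) this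
        rw [Nat.cast_mul, Nat.cast_mul, Nat.cast_sub hkj] at this
        push_cast at this ⊢
        linarith
      · simp [Nat.choose_eq_zero_of_lt hkj, Nat.choose_eq_zero_of_lt (show j < k by omega)]
  rcases k with _ | k
  · simp only [Nat.choose_zero_right, Nat.choose_one_right, zero_add, Nat.cast_zero, Nat.cast_one,
      pow_zero, pow_one]
    ring
  · have hpas : ((j + 1).choose (k + 1) : ℝ) = j.choose k + j.choose (k + 1) := by
      exact_mod_cast Nat.choose_succ_succ j k
    have hprev : ((k : ℝ) + 1) * (j.choose (k + 1) : ℝ) = ((j : ℝ) - k) * (j.choose k : ℝ) := by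
      have := congrArg (Nat.cast : ℕ → ℝ) (Nat.add_one_mul_choose_eq j k)
      push_cast [hpas] at this
      linarith
    simp only [Nat.add_sub_cancel, hpas]
    push_cast at hup hdown ⊢
    have hs : (-1 : ℝ) ^ (k + 1 + 1) = - (-1) ^ (k + 1) := by ring
    have hs' : (-1 : ℝ) ^ k = - (-1) ^ (k + 1) := by ring
    rw [hs, hs']
    generalize (-1 : ℝ) ^ (k + 1) = s
    linear_combination s * ((N : ℝ) ^ 2 - (j : ℝ) ^ 2) * hdown
      - s * ((N : ℝ) ^ 2 - ((k : ℝ) + 2) ^ 2) * hup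
      - s * ((N : ℝ) ^ 2 - (((j : ℝ) + 1) ^ 2 + ((j : ℝ) + 1) * (k + 1) + ((k : ℝ) + 1) ^ 2)) * hprev

theorem eigenvalue_eq_of_psiMat_mul_lamMat_mulVec (N : ℕ) (lam ε : ℝ) (hε : ε ≠ 0)
    (v : Fin N → ℝ) (hv : v ≠ 0) (h : (jacobiJ N).mulVec v = lam • v)
    (hB : (psiMat N * lamMat N).mulVec v = ε • v) : lam = ((N : ℝ) ^ 2 - 1) / 2 := by
  have key := congrArg (fun M => M.mulVec v) (jacobiJ_mul_add_mul_jacobiJ N)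
  simp only [Matrix.add_mulVec, Matrix.smul_mulVec] at key
  rw [← Matrix.mulVec_mulVec, ← Matrix.mulVec_mulVec v (psiMat N * lamMat N) (jacobiJ N),
    h, hB, Matrix.mulVec_smul, Matrix.mulVec_smul, h, hB] at key
  obtain ⟨i, hi⟩ := Function.ne_iff.mp hv
  have hi' := congrFun key i
  simp only [Pi.add_apply, Pi.smul_apply, smul_eq_mul, Pi.zero_apply] at hi' hi
  have := mul_right_cancel₀ (mul_ne_zero hε hi)
    (show (2 * lam) * (ε * v i) = ((N : ℝ) ^ 2 - 1) * (ε * v i) by linarith)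
  linarith

/-- If `v` is a nonzero eigenvector of `J_N` with eigenvalue `λ ≠ (N² - 1)/2`, and
`u = (Ψ_N Λ_N) v` is its binomial transform, then `v + u` and `v - u` are nonzero
eigenvectors of the binomial transform `Ψ_N Λ_N` with eigenvalues `+1` and `-1`. -/
theorem binomial_transform_eigenvectors (N : ℕ) (lam : ℝ)
    (hlam : lam ≠ ((N : ℝ) ^ 2 - 1) / 2) (v : Fin N → ℝ) (hv : v ≠ 0)
    (h : (jacobiJ N).mulVec v = lam • v) :
    v + (psiMat N * lamMat N).mulVec v ≠ 0 ∧
    v - (psiMat N * lamMat N).mulVec v ≠ 0 ∧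
    (psiMat N * lamMat N).mulVec (v + (psiMat N * lamMat N).mulVec v)
      = v + (psiMat N * lamMat N).mulVec v ∧
    (psiMat N * lamMat N).mulVec (v - (psiMat N * lamMat N).mulVec v)
      = -(v - (psiMat N * lamMat N).mulVec v) := by
  have hinv : (psiMat N * lamMat N).mulVec ((psiMat N * lamMat N).mulVec v) = v := by
    rw [Matrix.mulVec_mulVec, psiMat_mul_lamMat_mul_self, Matrix.one_mulVec]
  refine ⟨fun h0 => hlam ?_, fun h0 => hlam ?_, ?_, ?_⟩
  · refine eigenvalue_eq_of_psiMat_mul_lamMat_mulVec N lam (-1) (by norm_num) v hv h ?_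
    rw [neg_one_smul]
    exact eq_neg_of_add_eq_zero_right h0
  · refine eigenvalue_eq_of_psiMat_mul_lamMat_mulVec N lam 1 one_ne_zero v hv h ?_
    rw [one_smul]
    exact (sub_eq_zero.mp h0).symm
  · rw [Matrix.mulVec_add, hinv, add_comm]
  · rw [Matrix.mulVec_sub, hinv, neg_sub]
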